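/- arXiv:2409.08756 — 2 statements merged into one kernel-verified Lean document; each statement's English description precedes it below -/
import Mathlib

section
/- For the generic quadratic model f with an admissible design x_1,…,x_n, true parameter θ* ∈ ℝ^{d+1}, Gaussian noise of standard deviation σ > 0, sigma-point parameter κ ∈ (−n,∞), and noise-free observations y = y* (so that θ̄ = θ̂(y*) = θ*): for every x ∈ [−1,1]^d, the sigma-point approximation satisfies V^SP(x) − V(x) = (σ^4/(2n^2)) ( (κ/(2n)) (Σ_{k=1}^d (β_k/α_k^2)(x_k^2 − 1))^2 − Σ_{k=1}^d (β_k^2/α_k^4)(x_k^2 − 1)^2 ). -/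
open Finset MeasureTheory Real

/-- The generic quadratic model
`f(x,θ) = θ₀ + ∑ₖ αₖ θₖ xₖ + ∑ₖ βₖ (θₖ²/2) xₖ²`. -/
noncomputable def model (d : ℕ) (α β : Fin d → ℝ) (x : Fin d → ℝ)
    (θ : Fin (d + 1) → ℝ) : ℝ :=
  θ 0 + (∑ k, α k * θ k.succ * x k) + (∑ k, β k * (θ k.succ) ^ 2 / 2 * (x k) ^ 2)

/-- Admissibility of an experimental design: all design points are corners of `[-1,1]^d`,
they sum to zero, and the design is orthogonal. -/
def Admissible (d n : ℕ) (X : Fin n → Fin d → ℝ) : Prop :=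
  (∀ i k, X i k = 1 ∨ X i k = -1) ∧
  (∀ k, ∑ i, X i k = 0) ∧
  (∀ k l, ∑ i, X i k * X i l = (n : ℝ) * (if k = l then 1 else 0))

/-- The closed-form least-squares estimator for the generic quadratic model. -/
noncomputable def lse (d n : ℕ) (α β : Fin d → ℝ) (X : Fin n → Fin d → ℝ)
    (y : Fin n → ℝ) : Fin (d + 1) → ℝ :=
  Fin.cons
    ((1 / (n : ℝ)) * (∑ i, y i)
      - ∑ k, β k / (2 * (α k) ^ 2 * (n : ℝ) ^ 2) * (∑ i, X i k * y i) ^ 2)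
    (fun k => (1 / (α k * (n : ℝ))) * ∑ i, X i k * y i)

/-- The sum of squared errors. -/
noncomputable def sse (d n : ℕ) (α β : Fin d → ℝ) (X : Fin n → Fin d → ℝ)
    (y : Fin n → ℝ) (θ : Fin (d + 1) → ℝ) : ℝ :=
  ∑ i, (model d α β (X i) θ - y i) ^ 2

/-- Density of the `n`-dimensional Gaussian with mean `0` and covariance `σ² I`. -/
noncomputable def gauss (n : ℕ) (σ : ℝ) (z : Fin n → ℝ) : ℝ :=
  (2 * π * σ ^ 2) ^ (-(n : ℝ) / 2) * Real.exp (-(∑ i, (z i) ^ 2) / (2 * σ ^ 2))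

/-- The noise-free observations `y* = (f(x₁,θ*),…,f(xₙ,θ*))`. -/
noncomputable def yStar (d n : ℕ) (α β : Fin d → ℝ) (X : Fin n → Fin d → ℝ)
    (θs : Fin (d + 1) → ℝ) : Fin n → ℝ :=
  fun i => model d α β (X i) θs

/-- The expected prediction `μ(x) = ∫ f(x, θ̂(y* + z)) p(z) dz`. -/
noncomputable def predMean (d n : ℕ) (α β : Fin d → ℝ) (X : Fin n → Fin d → ℝ)
    (θs : Fin (d + 1) → ℝ) (σ : ℝ) (x : Fin d → ℝ) : ℝ :=
  ∫ z : Fin n → ℝ, model d α β x (lse d n α β X (yStar d n α β X θs + z)) * gauss n σ z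

/-- The prediction uncertainty `V(x) = ∫ (f(x, θ̂(y* + z)) − μ(x))² p(z) dz`. -/
noncomputable def predVar (d n : ℕ) (α β : Fin d → ℝ) (X : Fin n → Fin d → ℝ)
    (θs : Fin (d + 1) → ℝ) (σ : ℝ) (x : Fin d → ℝ) : ℝ :=
  ∫ z : Fin n → ℝ,
    (model d α β x (lse d n α β X (yStar d n α β X θs + z))
        - predMean d n α β X θs σ x) ^ 2 * gauss n σ z

/-- `g(x,z) = f(x, θ̂(ȳ + z))` where `ȳ` are the predictions of the model estimated from `y`. -/
noncomputable def spG (d n : ℕ) (α β : Fin d → ℝ) (X : Fin n → Fin d → ℝ)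
    (y : Fin n → ℝ) (x : Fin d → ℝ) (z : Fin n → ℝ) : ℝ :=
  model d α β x (lse d n α β X ((fun i => model d α β (X i) (lse d n α β X y)) + z))

/-- The sigma-point approximation to the expected prediction. -/
noncomputable def spMean (d n : ℕ) (α β : Fin d → ℝ) (X : Fin n → Fin d → ℝ)
    (y : Fin n → ℝ) (σ κ : ℝ) (x : Fin d → ℝ) : ℝ :=
  (κ / ((n : ℝ) + κ)) * spG d n α β X y x 0
    + (1 / (2 * ((n : ℝ) + κ))) * ∑ i : Fin n,
        (spG d n α β X y x (fun j => if j = i then σ * Real.sqrt ((n : ℝ) + κ) else 0)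
          + spG d n α β X y x (fun j => if j = i then -(σ * Real.sqrt ((n : ℝ) + κ)) else 0))

/-- The sigma-point approximation to the prediction uncertainty. -/
noncomputable def spVar (d n : ℕ) (α β : Fin d → ℝ) (X : Fin n → Fin d → ℝ)
    (y : Fin n → ℝ) (σ κ : ℝ) (x : Fin d → ℝ) : ℝ :=
  (κ / ((n : ℝ) + κ)) * (spG d n α β X y x 0 - spMean d n α β X y σ κ x) ^ 2
    + (1 / (2 * ((n : ℝ) + κ))) * ∑ i : Fin n,
        ((spG d n α β X y x (fun j => if j = i then σ * Real.sqrt ((n : ℝ) + κ) else 0)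
            - spMean d n α β X y σ κ x) ^ 2
          + (spG d n α β X y x (fun j => if j = i then -(σ * Real.sqrt ((n : ℝ) + κ)) else 0)
              - spMean d n α β X y σ κ x) ^ 2)

open ProbabilityTheory in
/-- The density is the product of one-dimensional Gaussian densities. -/
lemma gauss_eq_prod (n : ℕ) (σ : ℝ) (hσ : 0 < σ) (z : Fin n → ℝ) :
    gauss n σ z = ∏ i, gaussianPDFReal 0 (Real.toNNReal (σ ^ 2)) (z i) := by
  have hp : (0 : ℝ) ≤ 2 * π * σ ^ 2 := by positivity
  simp only [gaussianPDFReal, gauss, Real.coe_toNNReal _ (sq_nonneg σ), Finset.prod_mul_distrib, sub_zero,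
    ← Real.exp_sum, Finset.prod_const, Finset.card_univ, Fintype.card_fin]
  congr 1
  · rw [Real.sqrt_eq_rpow, ← Real.rpow_neg hp, ← Real.rpow_mul_natCast hp]
    congr 1
    ring
  · congr 1
    rw [neg_div, Finset.sum_div, ← Finset.sum_neg_distrib]
    simp only [neg_div]

/-- The linear form `z ↦ ∑ uᵢ zᵢ`. -/
noncomputable def lin (n : ℕ) (u z : Fin n → ℝ) : ℝ := ∑ i, u i * z i

open ProbabilityTheory in
lemma integral_exp_lin (n : ℕ) (σ : ℝ) (hσ : 0 < σ) (u : Fin n → ℝ) (t : ℝ) :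
    ∫ z : Fin n → ℝ, Real.exp (t * lin n u z) * gauss n σ z
      = Real.exp ((σ ^ 2 * ∑ i, u i ^ 2) * t ^ 2 / 2) := by
  set v : NNReal := Real.toNNReal (σ ^ 2) with hv
  have hv0 : v ≠ 0 := by
    have : 0 < v := Real.toNNReal_pos.mpr (by positivity)
    exact this.ne'
  have h1 : ∀ z : Fin n → ℝ, Real.exp (t * lin n u z) * gauss n σ z
      = ∏ i, (fun i (w : ℝ) => gaussianPDFReal 0 v w • Real.exp ((t * u i) * w)) i (z i) := by
    intro z
    simp only [gauss_eq_prod n σ hσ, smul_eq_mul, Finset.prod_mul_distrib, ← Real.exp_sum, lin,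
      Finset.mul_sum, mul_assoc]
    rw [mul_comm]
  rw [integral_congr_ae (ae_of_all _ h1)]
  rw [integral_fintype_prod_volume_eq_prod (E := fun _ : Fin n => ℝ)
    (f := fun i (w : ℝ) => gaussianPDFReal 0 v w • Real.exp ((t * u i) * w))]
  simp_rw [← integral_gaussianReal_eq_integral_smul hv0]
  have h2 : ∀ s : ℝ, ∫ w, Real.exp (s * w) ∂(gaussianReal 0 v) = Real.exp (v * s ^ 2 / 2) := by
    intro s
    have := congrFun (mgf_fun_id_gaussianReal (μ := 0) (v := v)) s
    simpa [mgf] using this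
  simp_rw [h2]
  rw [← Real.exp_sum]
  congr 1
  simp only [hv, Real.coe_toNNReal _ (sq_nonneg σ), Finset.mul_sum, Finset.sum_mul, Finset.sum_div]
  refine Finset.sum_congr rfl fun i _ => ?_
  ring

/-- The Gaussian measure. -/
noncomputable def gm (n : ℕ) (σ : ℝ) : Measure (Fin n → ℝ) :=
  volume.withDensity fun z => ENNReal.ofReal (gauss n σ z)

lemma gauss_nonneg (n : ℕ) (σ : ℝ) (z : Fin n → ℝ) : 0 ≤ gauss n σ z := by
  unfold gauss; positivity

lemma integral_gm (n : ℕ) (σ : ℝ) (h : (Fin n → ℝ) → ℝ) :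
    ∫ z, h z * gauss n σ z = ∫ z, h z ∂(gm n σ) := by
  unfold gm
  rw [integral_withDensity_eq_integral_toReal_smul]
  · simp only [ENNReal.toReal_ofReal (gauss_nonneg n σ _), smul_eq_mul, mul_comm]
  · unfold gauss; fun_prop
  · simp

lemma gm_prob (n : ℕ) (σ : ℝ) (hσ : 0 < σ) : IsProbabilityMeasure (gm n σ) := by
  have h := integral_exp_lin n σ hσ 0 0
  simp only [zero_mul, Real.exp_zero, one_mul] at h
  constructor
  have hi : Integrable (gauss n σ) := by
    by_contra hc
    rw [integral_undef hc] at h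
    simp at h
  unfold gm
  rw [withDensity_apply _ MeasurableSet.univ, Measure.restrict_univ,
    ← ofReal_integral_eq_lintegral_ofReal hi (ae_of_all _ (gauss_nonneg n σ)), h]
  simp

lemma mgf_lin (n : ℕ) (σ : ℝ) (hσ : 0 < σ) (u : Fin n → ℝ) :
    ProbabilityTheory.mgf (lin n u) (gm n σ)
      = fun t => Real.exp ((σ ^ 2 * ∑ i, u i ^ 2) * t ^ 2 / 2) := by
  ext t
  rw [ProbabilityTheory.mgf, ← integral_gm, integral_exp_lin n σ hσ]

lemma zero_mem_int (n : ℕ) (σ : ℝ) (hσ : 0 < σ) (u : Fin n → ℝ) :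
    0 ∈ interior (ProbabilityTheory.integrableExpSet (lin n u) (gm n σ)) := by
  have := gm_prob n σ hσ
  have h : ProbabilityTheory.integrableExpSet (lin n u) (gm n σ) = Set.univ := by
    ext t
    simp only [ProbabilityTheory.integrableExpSet, Set.mem_ofPred_eq, Set.mem_univ, iff_true]
    rw [← ProbabilityTheory.mgf_pos_iff, mgf_lin n σ hσ]
    exact Real.exp_pos _
  simp [h]

lemma int_pow (n : ℕ) (σ : ℝ) (hσ : 0 < σ) (u : Fin n → ℝ) (m : ℕ) :
    Integrable (fun z => lin n u z ^ m) (gm n σ) :=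
  ProbabilityTheory.integrable_pow_of_mem_interior_integrableExpSet (zero_mem_int n σ hσ u) m

lemma mom_eq (n : ℕ) (σ : ℝ) (hσ : 0 < σ) (u : Fin n → ℝ) (m : ℕ) :
    ∫ z, lin n u z ^ m ∂(gm n σ)
      = iteratedDeriv m (fun t => Real.exp ((σ ^ 2 * ∑ i, u i ^ 2) * t ^ 2 / 2)) 0 := by
  rw [← mgf_lin n σ hσ, ProbabilityTheory.iteratedDeriv_mgf_zero (zero_mem_int n σ hσ u)]
  rfl

lemma deriv_poly_exp (v : ℝ) (p pd : ℝ → ℝ) (hp : ∀ t, HasDerivAt p (pd t) t) :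
    deriv (fun t => p t * Real.exp (v * t ^ 2 / 2))
      = fun t => (pd t + v * t * p t) * Real.exp (v * t ^ 2 / 2) := by
  ext t
  have h1 : HasDerivAt (fun t : ℝ => v * t ^ 2 / 2) (v * t) t := by
    have := (((hasDerivAt_id t).pow 2).const_mul v).div_const 2
    refine this.congr_deriv ?_
    simp; ring
  refine (((hp t).mul h1.exp).deriv).trans ?_
  ring

lemma iter1 (v : ℝ) : iteratedDeriv 1 (fun t => Real.exp (v * t ^ 2 / 2))
    = fun t => (v * t) * Real.exp (v * t ^ 2 / 2) := by
  have := deriv_poly_exp v (fun _ => 1) (fun _ => 0) (fun t => hasDerivAt_const t 1)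
  simpa using this

lemma iter2 (v : ℝ) : iteratedDeriv 2 (fun t => Real.exp (v * t ^ 2 / 2))
    = fun t => (v + v ^ 2 * t ^ 2) * Real.exp (v * t ^ 2 / 2) := by
  rw [iteratedDeriv_succ, iter1, deriv_poly_exp v (fun t => v * t) (fun _ => v)]
  · ext t; ring
  · intro t
    simpa using (hasDerivAt_id t).const_mul v

lemma iter3 (v : ℝ) : iteratedDeriv 3 (fun t => Real.exp (v * t ^ 2 / 2))
    = fun t => (3 * v ^ 2 * t + v ^ 3 * t ^ 3) * Real.exp (v * t ^ 2 / 2) := by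
  rw [iteratedDeriv_succ, iter2, deriv_poly_exp v (fun t => v + v ^ 2 * t ^ 2)
    (fun t => 2 * v ^ 2 * t)]
  · ext t; ring
  · intro t
    have := (((hasDerivAt_id t).pow 2).const_mul (v ^ 2)).const_add v
    refine this.congr_deriv ?_
    simp; ring

lemma iter4 (v : ℝ) : iteratedDeriv 4 (fun t => Real.exp (v * t ^ 2 / 2))
    = fun t => (3 * v ^ 2 + 6 * v ^ 3 * t ^ 2 + v ^ 4 * t ^ 4) * Real.exp (v * t ^ 2 / 2) := by
  rw [iteratedDeriv_succ, iter3, deriv_poly_exp v (fun t => 3 * v ^ 2 * t + v ^ 3 * t ^ 3)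
    (fun t => 3 * v ^ 2 + 3 * v ^ 3 * t ^ 2)]
  · ext t; ring
  · intro t
    have := ((hasDerivAt_id t).const_mul (3 * v ^ 2)).add
      (((hasDerivAt_id t).pow 3).const_mul (v ^ 3))
    refine this.congr_deriv ?_
    simp; ring

section moments
variable (n : ℕ) (σ : ℝ) (hσ : 0 < σ) (u w : Fin n → ℝ)

lemma mom1 (hσ : 0 < σ) : ∫ z, lin n u z ∂(gm n σ) = 0 := by
  have := mom_eq n σ hσ u 1
  rw [iter1] at this
  simpa using this

lemma mom2 (hσ : 0 < σ) : ∫ z, lin n u z ^ 2 ∂(gm n σ) = σ ^ 2 * ∑ i, u i ^ 2 := by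
  rw [mom_eq n σ hσ u 2, iter2]; simp

lemma mom3 (hσ : 0 < σ) : ∫ z, lin n u z ^ 3 ∂(gm n σ) = 0 := by
  rw [mom_eq n σ hσ u 3, iter3]; simp

lemma mom4 (hσ : 0 < σ) :
    ∫ z, lin n u z ^ 4 ∂(gm n σ) = 3 * (σ ^ 2 * ∑ i, u i ^ 2) ^ 2 := by
  rw [mom_eq n σ hσ u 4, iter4]; simp

lemma lin_add (z : Fin n → ℝ) : lin n (u + w) z = lin n u z + lin n w z := by
  simp [lin, add_mul, Finset.sum_add_distrib]

lemma lin_sub (z : Fin n → ℝ) : lin n (u - w) z = lin n u z - lin n w z := by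
  simp [lin, sub_mul, Finset.sum_sub_distrib]

lemma mom12 (hσ : 0 < σ) : Integrable (fun z => lin n u z * lin n w z ^ 2) (gm n σ) ∧
    ∫ z, lin n u z * lin n w z ^ 2 ∂(gm n σ) = 0 := by
  have h : (fun z => lin n u z * lin n w z ^ 2) = fun z =>
      (1 / 6) * (lin n (u + w) z ^ 3 + lin n (u - w) z ^ 3 - 2 * lin n u z ^ 3) := by
    ext z; rw [lin_add, lin_sub]; ring
  have i1 := int_pow n σ hσ (u + w) 3
  have i2 := int_pow n σ hσ (u - w) 3
  have i3 := int_pow n σ hσ u 3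
  have i12 : Integrable (fun z => lin n (u + w) z ^ 3 + lin n (u - w) z ^ 3) (gm n σ) :=
    i1.add i2
  rw [h]
  refine ⟨((i1.add i2).sub (i3.const_mul 2)).const_mul _, ?_⟩
  rw [integral_const_mul, integral_sub i12 (i3.const_mul 2), integral_add i1 i2,
    integral_const_mul, mom3 n σ _ hσ, mom3 n σ _ hσ, mom3 n σ _ hσ]
  simp

lemma mom22 (hσ : 0 < σ) : Integrable (fun z => lin n u z ^ 2 * lin n w z ^ 2) (gm n σ) ∧
    ∫ z, lin n u z ^ 2 * lin n w z ^ 2 ∂(gm n σ)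
      = σ ^ 4 * ((∑ i, u i ^ 2) * (∑ i, w i ^ 2) + 2 * (∑ i, u i * w i) ^ 2) := by
  have h : (fun z => lin n u z ^ 2 * lin n w z ^ 2) = fun z =>
      (1 / 12) * ((lin n (u + w) z ^ 4 + lin n (u - w) z ^ 4)
        - (2 * lin n u z ^ 4 + 2 * lin n w z ^ 4)) := by
    ext z; rw [lin_add, lin_sub]; ring
  have i1 := int_pow n σ hσ (u + w) 4
  have i2 := int_pow n σ hσ (u - w) 4
  have i3 := (int_pow n σ hσ u 4).const_mul 2
  have i4 := (int_pow n σ hσ w 4).const_mul 2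
  have i12 : Integrable (fun z => lin n (u + w) z ^ 4 + lin n (u - w) z ^ 4) (gm n σ) :=
    i1.add i2
  have i34 : Integrable (fun z => 2 * lin n u z ^ 4 + 2 * lin n w z ^ 4) (gm n σ) :=
    i3.add i4
  rw [h]
  refine ⟨((i1.add i2).sub (i3.add i4)).const_mul _, ?_⟩
  rw [integral_const_mul, integral_sub i12 i34, integral_add i1 i2,
    integral_add i3 i4, integral_const_mul, integral_const_mul,
    mom4 n σ _ hσ, mom4 n σ _ hσ, mom4 n σ _ hσ, mom4 n σ _ hσ]
  have e1 : ∑ i, (u + w) i ^ 2 = (∑ i, u i ^ 2) + 2 * (∑ i, u i * w i) + ∑ i, w i ^ 2 := by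
    simp only [Pi.add_apply, Finset.mul_sum, ← Finset.sum_add_distrib]
    exact Finset.sum_congr rfl fun i _ => by ring
  have e2 : ∑ i, (u - w) i ^ 2 = (∑ i, u i ^ 2) - 2 * (∑ i, u i * w i) + ∑ i, w i ^ 2 := by
    simp only [Pi.sub_apply, Finset.mul_sum, ← Finset.sum_add_distrib, ← Finset.sum_sub_distrib]
    exact Finset.sum_congr rfl fun i _ => by ring
  rw [e1, e2]
  ring

end moments

/-- Mean of a quadratic function of the noise. -/
lemma quad_mean (d n : ℕ) (X : Fin n → Fin d → ℝ) (hX : Admissible d n X) (σ : ℝ) (hσ : 0 < σ)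
    (c : ℝ) (a : Fin n → ℝ) (q : Fin d → ℝ) :
    ∫ z, (c + lin n a z + ∑ k, q k * lin n (fun i => X i k) z ^ 2) ∂(gm n σ)
      = c + σ ^ 2 * n * ∑ k, q k := by
  have := gm_prob n σ hσ
  have i1 : Integrable (fun z => lin n a z) (gm n σ) := by simpa using int_pow n σ hσ a 1
  have i2 : ∀ k, Integrable (fun z => q k * lin n (fun i => X i k) z ^ 2) (gm n σ) :=
    fun k => (int_pow n σ hσ _ 2).const_mul _
  have i12 : Integrable (fun z => c + lin n a z) (gm n σ) := (integrable_const c).add i1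
  rw [integral_add i12 (integrable_finsetSum _ fun k _ => i2 k),
    integral_add (integrable_const c) i1, integral_finsetSum _ (fun k _ => i2 k), mom1 n σ a hσ]
  have hs : ∀ k, ∑ i, X i k ^ 2 = n := fun k => by
    have := hX.2.2 k k
    simp only [if_true, mul_one] at this
    rw [← this]
    exact Finset.sum_congr rfl fun i _ => by ring
  simp only [integral_const_mul, mom2 n σ _ hσ, hs]
  simp [← Finset.sum_mul, mul_comm]

/-- Variance of a quadratic function of the noise. -/
lemma quad_var (d n : ℕ) (X : Fin n → Fin d → ℝ) (hX : Admissible d n X) (σ : ℝ) (hσ : 0 < σ)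
    (c : ℝ) (a : Fin n → ℝ) (q : Fin d → ℝ) :
    ∫ z, (c + lin n a z + ∑ k, q k * lin n (fun i => X i k) z ^ 2
        - (c + σ ^ 2 * n * ∑ k, q k)) ^ 2 ∂(gm n σ)
      = σ ^ 2 * ∑ i, a i ^ 2 + 2 * σ ^ 4 * n ^ 2 * ∑ k, q k ^ 2 := by
  have := gm_prob n σ hσ
  set s : ℝ := σ ^ 2 * n with hs'
  set S : Fin d → (Fin n → ℝ) → ℝ := fun k z => lin n (fun i => X i k) z with hS
  have hs : ∀ k, ∑ i, X i k ^ 2 = n := fun k => by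
    have := hX.2.2 k k
    simp only [if_true, mul_one] at this
    rw [← this]
    exact Finset.sum_congr rfl fun i _ => by ring
  have hexp : ∀ z, (c + lin n a z + ∑ k, q k * S k z ^ 2 - (c + s * ∑ k, q k)) ^ 2
      = lin n a z ^ 2 + ∑ k, (2 * q k) * (lin n a z * S k z ^ 2 - s * lin n a z)
        + ∑ k, ∑ l, (q k * q l) * (S k z ^ 2 * S l z ^ 2 - s * S k z ^ 2 - s * S l z ^ 2
          + s ^ 2) := by
    intro z
    have e0 : c + lin n a z + ∑ k, q k * S k z ^ 2 - (c + s * ∑ k, q k)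
        = lin n a z + ∑ k, q k * (S k z ^ 2 - s) := by
      simp only [mul_sub, Finset.sum_sub_distrib, ← Finset.sum_mul]
      ring
    have e1 : (∑ k, q k * (S k z ^ 2 - s)) ^ 2
        = ∑ k, ∑ l, (q k * q l) * (S k z ^ 2 * S l z ^ 2 - s * S k z ^ 2 - s * S l z ^ 2
          + s ^ 2) := by
      rw [sq, Finset.sum_mul_sum]
      exact Finset.sum_congr rfl fun k _ => Finset.sum_congr rfl fun l _ => by ring
    rw [e0, add_sq, e1, Finset.mul_sum]
    congr 2
    exact Finset.sum_congr rfl fun k _ => by ring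
  have hfun : (fun z => (c + lin n a z + ∑ k, q k * S k z ^ 2 - (c + s * ∑ k, q k)) ^ 2)
      = _ := funext hexp
  rw [hfun]
  have i1 : Integrable (fun z => lin n a z) (gm n σ) := by simpa using int_pow n σ hσ a 1
  have ia2 := int_pow n σ hσ a 2
  have iS : ∀ k, Integrable (fun z => s * S k z ^ 2) (gm n σ) :=
    fun k => (int_pow n σ hσ _ 2).const_mul _
  have iLS : ∀ k, Integrable (fun z => lin n a z * S k z ^ 2) (gm n σ) :=
    fun k => (mom12 n σ a _ hσ).1
  have iSS : ∀ k l, Integrable (fun z => S k z ^ 2 * S l z ^ 2) (gm n σ) :=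
    fun k l => (mom22 n σ _ _ hσ).1
  have iA : ∀ k, Integrable
      (fun z => (2 * q k) * (lin n a z * S k z ^ 2 - s * lin n a z)) (gm n σ) :=
    fun k => ((iLS k).sub (i1.const_mul s)).const_mul _
  have iB1 : ∀ k l, Integrable
      (fun z => S k z ^ 2 * S l z ^ 2 - s * S k z ^ 2) (gm n σ) :=
    fun k l => (iSS k l).sub (iS k)
  have iB2 : ∀ k l, Integrable
      (fun z => S k z ^ 2 * S l z ^ 2 - s * S k z ^ 2 - s * S l z ^ 2) (gm n σ) :=
    fun k l => (iB1 k l).sub (iS l)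
  have iB : ∀ k l, Integrable
      (fun z => (q k * q l) * (S k z ^ 2 * S l z ^ 2 - s * S k z ^ 2 - s * S l z ^ 2
          + s ^ 2)) (gm n σ) :=
    fun k l => ((iB2 k l).add (integrable_const _)).const_mul _
  have iBs : ∀ k, Integrable
      (fun z => ∑ l, (q k * q l) * (S k z ^ 2 * S l z ^ 2 - s * S k z ^ 2 - s * S l z ^ 2
          + s ^ 2)) (gm n σ) :=
    fun k => integrable_finsetSum _ fun l _ => iB k l
  have iAs := integrable_finsetSum Finset.univ fun k _ => iA k
  have iaA : Integrable (fun z => lin n a z ^ 2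
      + ∑ k, (2 * q k) * (lin n a z * S k z ^ 2 - s * lin n a z)) (gm n σ) := ia2.add iAs
  rw [integral_add iaA (integrable_finsetSum _ fun k _ => iBs k),
    integral_add ia2 iAs, integral_finsetSum _ (fun k _ => iA k),
    integral_finsetSum _ (fun k _ => iBs k), mom2 n σ a hσ]
  have vA : ∀ k, ∫ z, (2 * q k) * (lin n a z * S k z ^ 2 - s * lin n a z) ∂(gm n σ) = 0 := by
    intro k
    rw [integral_const_mul, integral_sub (iLS k) (i1.const_mul s), integral_const_mul,
      mom1 n σ a hσ, (mom12 n σ a _ hσ).2]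
    simp
  have vB : ∀ k l, ∫ z, (q k * q l) * (S k z ^ 2 * S l z ^ 2 - s * S k z ^ 2 - s * S l z ^ 2
          + s ^ 2) ∂(gm n σ) = if k = l then 2 * σ ^ 4 * n ^ 2 * q k ^ 2 else 0 := by
    intro k l
    rw [integral_const_mul, integral_add (iB2 k l) (integrable_const _),
      integral_sub (iB1 k l) (iS l), integral_sub (iSS k l) (iS k), integral_const_mul,
      integral_const_mul, (mom22 n σ _ _ hσ).2, mom2 n σ _ hσ, mom2 n σ _ hσ]
    simp only [hs, hX.2.2 k l, integral_const, probReal_univ, smul_eq_mul, hs']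
    split_ifs with hkl
    · subst hkl; ring
    · ring
  simp only [vA, Finset.sum_const_zero, add_zero]
  congr 1
  rw [Finset.mul_sum]
  refine Finset.sum_congr rfl fun k _ => ?_
  rw [integral_finsetSum _ (fun l _ => iB k l)]
  simp only [vB]
  simp

section algebra

/-- `∑ xᵢₖ y*ᵢ = n αₖ θₖ`. -/
lemma sum_X_yStar (d n : ℕ) (α β : Fin d → ℝ) (X : Fin n → Fin d → ℝ) (hX : Admissible d n X)
    (θs : Fin (d + 1) → ℝ) (k : Fin d) :
    ∑ i, X i k * yStar d n α β X θs i = n * (α k * θs k.succ) := by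
  have hsq : ∀ i l, X i l ^ 2 = 1 := fun i l => by rcases hX.1 i l with h | h <;> simp [h]
  simp only [yStar, model, hsq, mul_one]
  have e : ∀ i, X i k * (θs 0 + (∑ l, α l * θs l.succ * X i l) + ∑ l, β l * θs l.succ ^ 2 / 2)
      = (θs 0 + ∑ l, β l * θs l.succ ^ 2 / 2) * X i k
        + ∑ l, (α l * θs l.succ) * (X i k * X i l) := by
    intro i
    rw [mul_add, mul_add, Finset.mul_sum]
    have : ∑ l, X i k * (α l * θs l.succ * X i l) = ∑ l, (α l * θs l.succ) * (X i k * X i l) :=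
      Finset.sum_congr rfl fun l _ => by ring
    rw [this]; ring
  simp only [e, Finset.sum_add_distrib, ← Finset.mul_sum, hX.2.1 k]
  rw [Finset.sum_comm]
  simp only [← Finset.mul_sum, hX.2.2]
  simp
  ring

/-- `∑ y*ᵢ`. -/
lemma sum_yStar (d n : ℕ) (α β : Fin d → ℝ) (X : Fin n → Fin d → ℝ) (hX : Admissible d n X)
    (θs : Fin (d + 1) → ℝ) :
    ∑ i, yStar d n α β X θs i = n * (θs 0 + ∑ l, β l * θs l.succ ^ 2 / 2) := by
  have hsq : ∀ i l, X i l ^ 2 = 1 := fun i l => by rcases hX.1 i l with h | h <;> simp [h]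
  simp only [yStar, model, hsq, mul_one, Finset.sum_add_distrib]
  rw [Finset.sum_comm]
  simp only [← Finset.mul_sum, hX.2.1]
  simp
  ring

lemma lse_yStar (d n : ℕ) (hn : 1 ≤ n) (α β : Fin d → ℝ) (hα : ∀ k, α k ≠ 0)
    (X : Fin n → Fin d → ℝ) (hX : Admissible d n X) (θs : Fin (d + 1) → ℝ) :
    lse d n α β X (yStar d n α β X θs) = θs := by
  have hn0 : (n : ℝ) ≠ 0 := by exact_mod_cast (by omega : n ≠ 0)
  funext j
  refine Fin.cases ?_ (fun k => ?_) j
  · simp only [lse, Fin.cons_zero, sum_yStar d n α β X hX, sum_X_yStar d n α β X hX]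
    have : ∀ k, β k / (2 * α k ^ 2 * (n : ℝ) ^ 2) * (n * (α k * θs k.succ)) ^ 2
        = β k * θs k.succ ^ 2 / 2 := by
      intro k
      have := hα k
      field_simp
    simp only [this]
    field_simp
    ring
  · simp only [lse, Fin.cons_succ, sum_X_yStar d n α β X hX]
    have := hα k
    field_simp

/-- The prediction is a quadratic function of the noise. -/
lemma pred_quad (d n : ℕ) (hn : 1 ≤ n) (α β : Fin d → ℝ) (hα : ∀ k, α k ≠ 0)
    (X : Fin n → Fin d → ℝ) (hX : Admissible d n X) (θs : Fin (d + 1) → ℝ) (x : Fin d → ℝ) :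
    ∃ (c : ℝ) (a : Fin n → ℝ), ∀ z : Fin n → ℝ,
      model d α β x (lse d n α β X (yStar d n α β X θs + z))
        = c + lin n a z + ∑ k, (β k / α k ^ 2 * (x k ^ 2 - 1) / (2 * (n : ℝ) ^ 2))
            * lin n (fun i => X i k) z ^ 2 := by
  have hn0 : (n : ℝ) ≠ 0 := by exact_mod_cast (by omega : n ≠ 0)
  set b : Fin d → ℝ := fun k => x k / n + β k * θs k.succ * (x k ^ 2 - 1) / (α k * n) with hb
  refine ⟨θs 0 + ∑ l, β l * θs l.succ ^ 2 / 2 + ∑ k, (α k * θs k.succ * x k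
      + β k * θs k.succ ^ 2 / 2 * (x k ^ 2 - 1)),
    fun i => 1 / n + ∑ k, b k * X i k, fun z => ?_⟩
  have hl : lin n (fun i => 1 / n + ∑ k, b k * X i k) z
      = 1 / n * ∑ i, z i + ∑ k, b k * lin n (fun i => X i k) z := by
    simp only [lin, add_mul, Finset.sum_add_distrib, ← Finset.mul_sum, Finset.sum_mul]
    congr 1
    rw [Finset.sum_comm]
    refine Finset.sum_congr rfl fun k _ => ?_
    rw [Finset.mul_sum]
    exact Finset.sum_congr rfl fun i _ => by ring
  have h1 : ∀ k, ∑ i, X i k * (yStar d n α β X θs + z) i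
      = n * (α k * θs k.succ) + lin n (fun i => X i k) z := by
    intro k
    simp only [Pi.add_apply, mul_add, Finset.sum_add_distrib]
    rw [sum_X_yStar d n α β X hX]; rfl
  have h2 : ∑ i, (yStar d n α β X θs + z) i
      = n * (θs 0 + ∑ l, β l * θs l.succ ^ 2 / 2) + ∑ i, z i := by
    simp only [Pi.add_apply, Finset.sum_add_distrib]
    rw [sum_yStar d n α β X hX]
  rw [hl]
  simp only [model, lse, Fin.cons_zero, Fin.cons_succ, h1, h2]
  rw [mul_add, ← mul_assoc, one_div_mul_cancel hn0, one_mul]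
  have key : ∀ A B : ℝ, ∀ f1 f2 f3 g1 g2 g3 : Fin d → ℝ,
      (∀ k, - f1 k + f2 k + f3 k = g1 k + g2 k + g3 k) →
      A + B - ∑ k, f1 k + ∑ k, f2 k + ∑ k, f3 k
        = A + ∑ k, g1 k + (B + ∑ k, g2 k) + ∑ k, g3 k := by
    intro A B f1 f2 f3 g1 g2 g3 h
    have := Finset.sum_congr (rfl : (Finset.univ : Finset (Fin d)) = _) fun k _ => h k
    simp only [Finset.sum_add_distrib, Finset.sum_neg_distrib] at this
    linarith
  apply key
  intro k
  have := hα k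
  simp only [hb]
  field_simp
  ring

lemma lin_single (n : ℕ) (u : Fin n → ℝ) (i : Fin n) (t : ℝ) :
    lin n u (fun j => if j = i then t else 0) = u i * t := by
  simp [lin]

end algebra

/-- With noise-free observations `y = y*`, the difference between the
sigma-point approximation and the exact prediction uncertainty. -/
theorem stmt15 (d n : ℕ) (hd : 1 ≤ d) (hn : 1 ≤ n)
    (α β : Fin d → ℝ) (hα : ∀ k, α k ≠ 0)
    (X : Fin n → Fin d → ℝ) (hX : Admissible d n X)
    (θs : Fin (d + 1) → ℝ) (σ κ : ℝ) (hσ : 0 < σ) (hκ : -(n : ℝ) < κ)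
    (x : Fin d → ℝ) (hx : ∀ k, x k ∈ Set.Icc (-1 : ℝ) 1) :
    spVar d n α β X (yStar d n α β X θs) σ κ x - predVar d n α β X θs σ x
      = σ ^ 4 / (2 * (n : ℝ) ^ 2)
          * (κ / (2 * (n : ℝ)) * (∑ k, β k / (α k) ^ 2 * ((x k) ^ 2 - 1)) ^ 2
            - ∑ k, (β k) ^ 2 / (α k) ^ 4 * ((x k) ^ 2 - 1) ^ 2) := by
  have hn0 : (n : ℝ) ≠ 0 := by exact_mod_cast (by omega : n ≠ 0)
  have hnk : 0 < (n : ℝ) + κ := by linarith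
  obtain ⟨c, a, hg⟩ := pred_quad d n hn α β hα X hX θs x
  set q : Fin d → ℝ := fun k => β k / α k ^ 2 * (x k ^ 2 - 1) / (2 * (n : ℝ) ^ 2) with hq
  have hV : predVar d n α β X θs σ x
      = σ ^ 2 * ∑ i, a i ^ 2 + 2 * σ ^ 4 * n ^ 2 * ∑ k, q k ^ 2 := by
    have hm : predMean d n α β X θs σ x = c + σ ^ 2 * n * ∑ k, q k := by
      rw [← quad_mean d n X hX σ hσ c a q, predMean, integral_gm]
      simp only [hg, hq]
    rw [← quad_var d n X hX σ hσ c a q, predVar, hm, integral_gm]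
    simp only [hg, hq]
  have hsp : ∀ z, spG d n α β X (yStar d n α β X θs) x z
      = c + lin n a z + ∑ k, q k * lin n (fun i => X i k) z ^ 2 := by
    intro z
    rw [← hg z, spG, lse_yStar d n hn α β hα X hX]
    rfl
  have hsq : ∀ i l, X i l ^ 2 = 1 := fun i l => by rcases hX.1 i l with h | h <;> simp [h]
  have hsi : ∀ i t, spG d n α β X (yStar d n α β X θs) x (fun j => if j = i then t else 0)
      = c + a i * t + t ^ 2 * ∑ k, q k := by
    intro i t
    rw [hsp]
    simp only [lin_single, mul_pow, hsq, one_mul, ← Finset.sum_mul]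
    ring
  have hs0 : spG d n α β X (yStar d n α β X θs) x 0 = c := by
    rw [hsp]; simp [lin]
  set Q := ∑ k, q k with hQ
  set δ := σ * Real.sqrt ((n : ℝ) + κ) with hδ
  have hδ2 : δ ^ 2 = σ ^ 2 * (n + κ) := by rw [hδ, mul_pow, Real.sq_sqrt hnk.le]
  have hM : spMean d n α β X (yStar d n α β X θs) σ κ x = c + σ ^ 2 * n * Q := by
    have e : ∀ i, c + a i * δ + δ ^ 2 * Q + (c + a i * -δ + (-δ) ^ 2 * Q)
        = 2 * c + 2 * (σ ^ 2 * (n + κ)) * Q := by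
      intro i; rw [neg_sq, hδ2]; ring
    rw [spMean]
    simp only [← hδ, hsi, hs0, e]
    simp only [Finset.sum_const, Finset.card_univ, Fintype.card_fin, nsmul_eq_mul]
    field_simp
    ring
  have hS : spVar d n α β X (yStar d n α β X θs) σ κ x
      = σ ^ 2 * ∑ i, a i ^ 2 + n * κ * σ ^ 4 * Q ^ 2 := by
    have e : ∀ i, (c + a i * δ + δ ^ 2 * Q - (c + σ ^ 2 * n * Q)) ^ 2
        + (c + a i * -δ + (-δ) ^ 2 * Q - (c + σ ^ 2 * n * Q)) ^ 2
        = (2 * (σ ^ 2 * (n + κ))) * a i ^ 2 + 2 * (σ ^ 2 * κ * Q) ^ 2 := by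
      intro i
      rw [neg_sq]
      linear_combination (2 * a i ^ 2 + 2 * Q ^ 2 * (δ ^ 2 + σ ^ 2 * (n + κ))
        - 4 * Q ^ 2 * σ ^ 2 * n) * hδ2
    rw [spVar, hM]
    simp only [← hδ, hsi, hs0, e]
    simp only [Finset.sum_add_distrib, ← Finset.mul_sum, Finset.sum_const, Finset.card_univ,
      Fintype.card_fin, nsmul_eq_mul]
    field_simp
    ring
  have hQ' : ∑ k, β k / α k ^ 2 * (x k ^ 2 - 1) = 2 * (n : ℝ) ^ 2 * Q := by
    rw [hQ, Finset.mul_sum]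
    refine Finset.sum_congr rfl fun k _ => ?_
    simp only [hq]
    field_simp
  have hQ2 : ∑ k, β k ^ 2 / α k ^ 4 * (x k ^ 2 - 1) ^ 2 = 4 * (n : ℝ) ^ 4 * ∑ k, q k ^ 2 := by
    rw [Finset.mul_sum]
    refine Finset.sum_congr rfl fun k _ => ?_
    have := hα k
    simp only [hq]
    field_simp
    norm_num
  rw [hV, hS, hQ', hQ2]
  field_simp
  ring
end

section
/- For the generic quadratic model f with an admissible design x_1,…,x_n, true parameter θ* ∈ ℝ^{d+1} and Gaussian noise of standard deviation σ > 0: suppose z^(1),…,z^(N) ∈ ℝ^n and weights w_1,…,w_N ∈ ℝ form a cubature rule that is exact for all polynomials of total degree at most 4 with respect to the Gaussian density, i.e. Σ_{j=1}^N w_j q(z^(j)) = ∫_{ℝ^n} q(z) p(z) dz for every polynomial function q: ℝ^n → ℝ of total degree at most 4. Then for every x ∈ [−1,1]^d, the cubature rule applied around the noise-free observations y* computes the expected prediction and the prediction uncertainty exactly: Σ_{j=1}^N w_j f(x, θ̂(y* + z^(j))) = μ(x) and Σ_{j=1}^N w_j (f(x, θ̂(y* + z^(j))) − μ(x))^2 =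 V(x). -/
open Finset MeasureTheory Real

/-- `g` is a polynomial function of total degree at most `k`. -/
def IsPolyFun (n k : ℕ) (g : (Fin n → ℝ) → ℝ) : Prop :=
  ∃ q : MvPolynomial (Fin n) ℝ, q.totalDegree ≤ k ∧ ∀ z, MvPolynomial.eval z q = g z

theorem IsPolyFun.mono {n k l : ℕ} {g : (Fin n → ℝ) → ℝ} (h : IsPolyFun n k g)
    (hkl : k ≤ l) : IsPolyFun n l g := by
  obtain ⟨q, hq, he⟩ := h
  exact ⟨q, hq.trans hkl, he⟩

theorem IsPolyFun.const {n k : ℕ} (c : ℝ) : IsPolyFun n k (fun _ => c) :=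
  ⟨MvPolynomial.C c, by simp, by simp⟩

theorem IsPolyFun.coord {n : ℕ} (i : Fin n) : IsPolyFun n 1 (fun z => z i) :=
  ⟨MvPolynomial.X i, by simp, by simp⟩

theorem IsPolyFun.add {n k : ℕ} {f g : (Fin n → ℝ) → ℝ} (hf : IsPolyFun n k f)
    (hg : IsPolyFun n k g) : IsPolyFun n k (fun z => f z + g z) := by
  obtain ⟨p, hp, hpe⟩ := hf
  obtain ⟨q, hq, hqe⟩ := hg
  exact ⟨p + q, (MvPolynomial.totalDegree_add p q).trans (max_le hp hq), by simp [hpe, hqe]⟩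

theorem IsPolyFun.mul {n k l : ℕ} {f g : (Fin n → ℝ) → ℝ} (hf : IsPolyFun n k f)
    (hg : IsPolyFun n l g) : IsPolyFun n (k + l) (fun z => f z * g z) := by
  obtain ⟨p, hp, hpe⟩ := hf
  obtain ⟨q, hq, hqe⟩ := hg
  exact ⟨p * q, (MvPolynomial.totalDegree_mul p q).trans (add_le_add hp hq), by simp [hpe, hqe]⟩

theorem IsPolyFun.smul {n k : ℕ} {f : (Fin n → ℝ) → ℝ} (c : ℝ) (hf : IsPolyFun n k f) :
    IsPolyFun n k (fun z => c * f z) := by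
  have := (IsPolyFun.const (n := n) (k := 0) c).mul hf
  rwa [zero_add] at this

theorem IsPolyFun.sub {n k : ℕ} {f g : (Fin n → ℝ) → ℝ} (hf : IsPolyFun n k f)
    (hg : IsPolyFun n k g) : IsPolyFun n k (fun z => f z - g z) := by
  have := hf.add (hg.smul (-1))
  convert this using 2
  ring

theorem IsPolyFun.sq {n k : ℕ} {f : (Fin n → ℝ) → ℝ} (hf : IsPolyFun n k f) :
    IsPolyFun n (k + k) (fun z => f z ^ 2) := by
  have := hf.mul hf
  convert this using 2
  ring

theorem IsPolyFun.sum {n k : ℕ} {ι : Type} (s : Finset ι) {f : ι → (Fin n → ℝ) → ℝ}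
    (hf : ∀ i, IsPolyFun n k (f i)) : IsPolyFun n k (fun z => ∑ i ∈ s, f i z) := by
  classical
  induction s using Finset.induction_on with
  | empty => simpa using IsPolyFun.const 0
  | insert a s ha ih =>
    simp only [Finset.sum_insert ha]
    exact (hf a).add ih

theorem isPolyFun_prediction (d n : ℕ) (α β : Fin d → ℝ) (X : Fin n → Fin d → ℝ)
    (ys : Fin n → ℝ) (x : Fin d → ℝ) :
    IsPolyFun n 2 (fun z => model d α β x (lse d n α β X (ys + z))) := by
  have hy : ∀ i, IsPolyFun n 1 (fun z => ys i + z i) :=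
    fun i => (IsPolyFun.const _).add (IsPolyFun.coord i)
  have hL : ∀ k, IsPolyFun n 1 (fun z => ∑ i, X i k * (ys i + z i)) :=
    fun k => IsPolyFun.sum _ fun i => (hy i).smul _
  have ht : ∀ k, IsPolyFun n 1
      (fun z => (1 / (α k * (n : ℝ))) * ∑ i, X i k * (ys i + z i)) :=
    fun k => (hL k).smul _
  simp only [model, lse, Fin.cons_zero, Fin.cons_succ, Pi.add_apply]
  refine ((IsPolyFun.sub ?_ ?_).add ?_).add ?_
  · exact ((IsPolyFun.sum _ hy).smul _).mono (by norm_num)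
  · exact IsPolyFun.sum _ fun k => (hL k).sq.smul _
  · refine IsPolyFun.sum _ fun k => ?_
    have := (((ht k).smul (α k * x k)).mono (show 1 ≤ 2 by norm_num))
    convert this using 2
    ring
  · refine IsPolyFun.sum _ fun k => ?_
    have := (ht k).sq.smul (β k / 2 * x k ^ 2)
    convert this using 2
    ring

/-- Any cubature rule exact for polynomials of total degree at most 4
with respect to the Gaussian density computes the expected prediction and the prediction
uncertainty of the generic quadratic model exactly. -/
theorem stmt18 (d n : ℕ) (hd : 1 ≤ d) (hn : 1 ≤ n)
    (α β : Fin d → ℝ) (hα : ∀ k, α k ≠ 0)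
    (X : Fin n → Fin d → ℝ) (hX : Admissible d n X)
    (θs : Fin (d + 1) → ℝ) (σ : ℝ) (hσ : 0 < σ)
    (N : ℕ) (zc : Fin N → Fin n → ℝ) (w : Fin N → ℝ)
    (hcub : ∀ q : MvPolynomial (Fin n) ℝ, q.totalDegree ≤ 4 →
      ∑ j, w j * MvPolynomial.eval (zc j) q
        = ∫ z : Fin n → ℝ, MvPolynomial.eval z q * gauss n σ z)
    (x : Fin d → ℝ) (hx : ∀ k, x k ∈ Set.Icc (-1 : ℝ) 1) :
    (∑ j, w j * model d α β x (lse d n α β X (yStar d n α β X θs + zc j))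
        = predMean d n α β X θs σ x)
      ∧ ∑ j, w j * (model d α β x (lse d n α β X (yStar d n α β X θs + zc j))
            - predMean d n α β X θs σ x) ^ 2
          = predVar d n α β X θs σ x := by
  have hP := isPolyFun_prediction d n α β X (yStar d n α β X θs) x
  have key : ∀ g : (Fin n → ℝ) → ℝ, IsPolyFun n 4 g →
      ∑ j, w j * g (zc j) = ∫ z : Fin n → ℝ, g z * gauss n σ z := by
    rintro g ⟨q, hq, he⟩
    simpa only [he] using hcub q hq
  exact ⟨key _ (hP.mono (by norm_num)), key _ (hP.sub (IsPolyFun.const _)).sq⟩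
end
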